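/- Let k ≥ 1, v = 2k, R = F_2[U, U^{-1}], and let M be the model complex C_1: the free R-module with basis {a, b, c, e, z_0} ∪ {z_r^s : 1 ≤ r ≤ v, s ∈ {1,2}}, with R-linear differential ∂ given by ∂a = b + c, ∂b = ∂c = U·e, ∂z_0 = z_1^1 + z_1^2, ∂z_r^s = z_{r-1}^s + z_{r+1}^s for even r with 0 < r < v, ∂z_v^s = z_{v-1}^s, and ∂ = 0 on e and on z_r^s for odd r. Then the homology ker(∂)/range(∂) is a free R-module of rank one, generated by the class of z_0 + Σ_{r even, 0 < r ≤ v} (z_r^1 + z_r^2). -/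

import Mathlib

/- The homology of the model complex C₁ is a free R-module of rank one, generated by the
class of z₀ + Σ_{r even, 0 < r ≤ v} (z_r^1 + z_r^2). -/

open LaurentPolynomial

/-- `R2` is the Laurent polynomial ring `F₂[U, U⁻¹]`. -/
abbrev R2 : Type := LaurentPolynomial (ZMod 2)

/-- The variable `U`. -/
noncomputable def U : R2 := T 1

/-- Basis `{a, b, c, e, z_0} ∪ {z_r^s : 1 ≤ r ≤ v, s ∈ {1,2}}` of the model complex `C₁`. -/
inductive ModelB (v : ℕ) : Type
  | a | b | c | e | z0 | z (s : Fin 2) (r : Fin v)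
  deriving DecidableEq

/-- The basis vector `z_r^{s+1}` for `1 ≤ r ≤ v`, extended by `0` outside that range. -/
noncomputable def zS (v : ℕ) (s : Fin 2) (r : ℕ) : ModelB v → R2 :=
  if h : 1 ≤ r ∧ r ≤ v then Pi.single (ModelB.z s ⟨r - 1, by omega⟩) 1 else 0

/-- The cycle `z_0 + Σ_{r even, 0 < r ≤ v} (z_r^1 + z_r^2)` generating the homology. -/
noncomputable def gen (v : ℕ) : ModelB v → R2 :=
  Pi.single ModelB.z0 1 +
    ∑ r ∈ (Finset.Icc 1 v).filter (fun r => Even r), (zS v 0 r + zS v 1 r)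

instance ModelB.instFinite (v : ℕ) : Finite (ModelB v) := by
  refine Finite.of_surjective
    (fun x : Fin 5 ⊕ Fin 2 × Fin v => match x with
      | .inl 0 => ModelB.a
      | .inl 1 => ModelB.b
      | .inl 2 => ModelB.c
      | .inl 3 => ModelB.e
      | .inl 4 => ModelB.z0
      | .inr (s, r) => ModelB.z s r) ?_
  rintro (_ | _ | _ | _ | _ | ⟨s, r⟩)
  exacts [⟨.inl 0, rfl⟩, ⟨.inl 1, rfl⟩, ⟨.inl 2, rfl⟩, ⟨.inl 3, rfl⟩, ⟨.inl 4, rfl⟩,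
    ⟨.inr (s, r), rfl⟩]

theorem R2.module_add_self {M : Type*} [AddCommGroup M] [Module R2 M] (x : M) : x + x = 0 := by
  have h : (2 : R2) = 0 := by
    have h2 : (2 : ZMod 2) = 0 := rfl
    rw [← map_ofNat (LaurentPolynomial.C : ZMod 2 →+* R2) 2, h2, map_zero]
  rw [← two_smul R2 x, h, zero_smul]

theorem zS_eq_single {v : ℕ} (s : Fin 2) (i : Fin v) :
    zS v s (i + 1) = Pi.single (ModelB.z s i) 1 := by
  have h : 1 ≤ (i : ℕ) + 1 ∧ (i : ℕ) + 1 ≤ v := by omega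
  simp [zS, h]

theorem zS_of_lt {v r : ℕ} (s : Fin 2) (h : v < r) : zS v s r = 0 :=
  dif_neg (by omega)

theorem zS_apply_z0 (v : ℕ) (s : Fin 2) (r : ℕ) : zS v s r ModelB.z0 = 0 := by
  unfold zS
  split_ifs <;> simp

/-- The sum of the `z_j^{s+1}` over even `j` with `r ≤ j ≤ v`. -/
noncomputable def evenTail (v : ℕ) (s : Fin 2) (r : ℕ) : ModelB v → R2 :=
  ∑ j ∈ (Finset.Icc r v).filter (fun j => Even j), zS v s j

theorem evenTail_of_lt {v r : ℕ} (s : Fin 2) (h : v < r) : evenTail v s r = 0 := by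
  simp [evenTail, Finset.Icc_eq_empty_of_lt h]

theorem evenTail_of_odd {v r : ℕ} (s : Fin 2) (hr : Odd r) (h : r + 1 ≤ v) :
    evenTail v s r = zS v s (r + 1) + evenTail v s (r + 2) := by
  have hset : (Finset.Icc r v).filter (fun j => Even j) =
      insert (r + 1) ((Finset.Icc (r + 2) v).filter (fun j => Even j)) := by
    ext j
    simp only [Finset.mem_filter, Finset.mem_Icc, Finset.mem_insert]
    grind
  rw [evenTail, hset, Finset.sum_insert (by simp), evenTail]

theorem gen_eq_add_evenTail (v : ℕ) :
    gen v = Pi.single ModelB.z0 1 + (evenTail v 0 1 + evenTail v 1 1) := by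
  rw [gen, Finset.sum_add_distrib, evenTail, evenTail]

theorem gen_apply_z0 (v : ℕ) : gen v ModelB.z0 = 1 := by
  simp [gen, Finset.sum_apply, zS_apply_z0]

/-- A homotopy between the identity of the model complex and the projection onto the span of
`gen v`. -/
noncomputable def modelHomotopy (v : ℕ) : (ModelB v → R2) →ₗ[R2] (ModelB v → R2) :=
  (Pi.basisFun R2 (ModelB v)).constr R2 fun
    | .c => Pi.single ModelB.a 1
    | .e => (T (-1) : R2) • Pi.single ModelB.b 1
    | .z s i => if Even (i : ℕ) then evenTail v s (i + 1) else 0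
    | _ => 0

theorem modelHomotopy_a (v : ℕ) : modelHomotopy v (Pi.single ModelB.a 1) = 0 := by
  rw [← Pi.basisFun_apply, modelHomotopy, Module.Basis.constr_basis]

theorem modelHomotopy_b (v : ℕ) : modelHomotopy v (Pi.single ModelB.b 1) = 0 := by
  rw [← Pi.basisFun_apply, modelHomotopy, Module.Basis.constr_basis]

theorem modelHomotopy_c (v : ℕ) :
    modelHomotopy v (Pi.single ModelB.c 1) = Pi.single ModelB.a 1 := by
  rw [← Pi.basisFun_apply, modelHomotopy, Module.Basis.constr_basis]

theorem modelHomotopy_e (v : ℕ) :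
    modelHomotopy v (Pi.single ModelB.e 1) = (T (-1) : R2) • Pi.single ModelB.b 1 := by
  rw [← Pi.basisFun_apply, modelHomotopy, Module.Basis.constr_basis]

theorem modelHomotopy_z0 (v : ℕ) : modelHomotopy v (Pi.single ModelB.z0 1) = 0 := by
  rw [← Pi.basisFun_apply, modelHomotopy, Module.Basis.constr_basis]

theorem modelHomotopy_single_z {v : ℕ} (s : Fin 2) (i : Fin v) :
    modelHomotopy v (Pi.single (ModelB.z s i) 1) =
      if Even (i : ℕ) then evenTail v s (i + 1) else 0 := by
  rw [← Pi.basisFun_apply, modelHomotopy, Module.Basis.constr_basis]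

theorem modelHomotopy_zS_of_odd {v r : ℕ} (s : Fin 2) (hr : Odd r) :
    modelHomotopy v (zS v s r) = evenTail v s r := by
  rcases lt_or_ge v r with h | h
  · rw [zS_of_lt s h, evenTail_of_lt s h, map_zero]
  · obtain ⟨m, rfl⟩ := hr
    have := modelHomotopy_single_z s (⟨2 * m, by omega⟩ : Fin v)
    rw [← zS_eq_single] at this
    simpa using this

theorem modelHomotopy_zS_of_even {v r : ℕ} (s : Fin 2) (hr : Even r) :
    modelHomotopy v (zS v s r) = 0 := by
  by_cases h : 1 ≤ r ∧ r ≤ v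
  · have := modelHomotopy_single_z s (⟨r - 1, by omega⟩ : Fin v)
    rw [← zS_eq_single, if_neg (by grind)] at this
    simpa [Nat.sub_add_cancel h.1] using this
  · rw [zS, dif_neg h, map_zero]

/-- A linear map on the model complex is determined by its values on the basis. -/
theorem modelB_linearMap_ext {v : ℕ} {f g : (ModelB v → R2) →ₗ[R2] (ModelB v → R2)}
    (ha : f (Pi.single ModelB.a 1) = g (Pi.single ModelB.a 1))
    (hb : f (Pi.single ModelB.b 1) = g (Pi.single ModelB.b 1))
    (hc : f (Pi.single ModelB.c 1) = g (Pi.single ModelB.c 1))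
    (he : f (Pi.single ModelB.e 1) = g (Pi.single ModelB.e 1))
    (hz0 : f (Pi.single ModelB.z0 1) = g (Pi.single ModelB.z0 1))
    (hz : ∀ s r, 1 ≤ r → r ≤ v → f (zS v s r) = g (zS v s r)) : f = g := by
  refine (Pi.basisFun R2 (ModelB v)).ext fun i => ?_
  rw [Pi.basisFun_apply]
  match i with
  | .a => exact ha
  | .b => exact hb
  | .c => exact hc
  | .e => exact he
  | .z0 => exact hz0
  | .z s r => rw [← zS_eq_single]; exact hz s _ (by omega) (by omega)

/-- Let `M` be the model complex `C₁` (`v = 2k`, `k ≥ 1`), the free `R2`-module on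
`{a,b,c,e,z_0} ∪ {z_r^s}` with differential `∂a = b + c`, `∂b = ∂c = U • e`,
`∂z_0 = z_1^1 + z_1^2`, `∂z_r^s = z_{r-1}^s + z_{r+1}^s` for even `r` with `0 < r < v`,
`∂z_v^s = z_{v-1}^s`, and `∂ = 0` on `e` and on `z_r^s` for odd `r`. Then the homology
`ker ∂ / range ∂` is a free `R2`-module of rank one generated by the class of
`z_0 + Σ_{r even, 0 < r ≤ v} (z_r^1 + z_r^2)`. -/
theorem modelC1_homology (k : ℕ) (hk : 1 ≤ k) (v : ℕ) (hv : v = 2 * k)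
    (d : (ModelB v → R2) →ₗ[R2] (ModelB v → R2))
    (hda : d (Pi.single ModelB.a 1) = Pi.single ModelB.b 1 + Pi.single ModelB.c 1)
    (hdb : d (Pi.single ModelB.b 1) = U • (Pi.single ModelB.e 1 : ModelB v → R2))
    (hdc : d (Pi.single ModelB.c 1) = U • (Pi.single ModelB.e 1 : ModelB v → R2))
    (hdz0 : d (Pi.single ModelB.z0 1) = zS v 0 1 + zS v 1 1)
    (hdzeven : ∀ s : Fin 2, ∀ r : ℕ, 0 < r → r < v → Even r →
      d (zS v s r) = zS v s (r - 1) + zS v s (r + 1))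
    (hdzv : ∀ s : Fin 2, d (zS v s v) = zS v s (v - 1))
    (hde : d (Pi.single ModelB.e 1) = 0)
    (hdzodd : ∀ s : Fin 2, ∀ r : ℕ, 1 ≤ r → r ≤ v → Odd r → d (zS v s r) = 0) :
    d ∘ₗ d = 0 ∧
    gen v ∈ LinearMap.ker d ∧
    (∀ x ∈ LinearMap.ker d, ∃ c : R2, x + c • gen v ∈ LinearMap.range d) ∧
    (∀ c : R2, c • gen v ∈ LinearMap.range d → c = 0) := by
  have hself (x : ModelB v → R2) : x + x = 0 := R2.module_add_self x
  have hveven : Even v := by simp [hv]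
  have hdz : ∀ s r, 0 < r → r ≤ v → Even r → d (zS v s r) = zS v s (r - 1) + zS v s (r + 1) := by
    intro s r h0 hrv hr
    rcases hrv.lt_or_eq with h | rfl
    · exact hdzeven s r h0 h hr
    · rw [hdzv, zS_of_lt s (Nat.lt_succ_self r), add_zero]
  have hdodd : ∀ s r, Odd r → d (zS v s r) = 0 := by
    intro s r hr
    rcases lt_or_ge v r with h | h
    · rw [zS_of_lt s h, map_zero]
    · exact hdzodd s r hr.pos h hr
  have hdtail : ∀ s n r, Odd r → v + 1 ≤ r + 2 * n → d (evenTail v s r) = zS v s r := by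
    intro s n
    induction n with
    | zero =>
      intro r _ h
      rw [evenTail_of_lt s (by omega), zS_of_lt s (by omega), map_zero]
    | succ n ih =>
      intro r hr h
      rcases lt_or_ge v r with hvr | hvr
      · rw [evenTail_of_lt s hvr, zS_of_lt s hvr, map_zero]
      · have hlt : r + 1 ≤ v := by grind
        rw [evenTail_of_odd s hr hlt, map_add, hdz s (r + 1) (by omega) hlt hr.add_one,
          ih (r + 2) (by grind) (by omega), add_assoc, hself, add_zero, Nat.add_sub_cancel]
  have hdd : d ∘ₗ d = 0 := by
    apply modelB_linearMap_ext
    · simp [hda, hdb, hdc, hself]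
    · simp [hdb, hde]
    · simp [hdc, hde]
    · simp [hde]
    · simp [hdz0, hdodd]
    · intro s r h1 hrv
      rcases Nat.even_or_odd r with hr | hr
      · simp [hdz s r h1 hrv hr, hdodd s _ hr.add_one, hdodd s (r - 1) (by grind)]
      · simp [hdodd s r hr]
  have hpd (x : ModelB v → R2) : d x ModelB.z0 = 0 := by
    suffices h : LinearMap.toSpanSingleton R2 (ModelB v → R2) (gen v) ∘ₗ
        LinearMap.proj ModelB.z0 ∘ₗ d = 0 by
      simpa [gen_apply_z0] using congrFun (LinearMap.congr_fun h x) ModelB.z0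
    apply modelB_linearMap_ext
    · simp [hda]
    · simp [hdb]
    · simp [hdc]
    · simp [hde]
    · simp [hdz0, zS_apply_z0]
    · intro s r h1 hrv
      rcases Nat.even_or_odd r with hr | hr
      · simp [hdz s r h1 hrv hr, zS_apply_z0]
      · simp [hdodd s r hr]
  have hTT : (U * T (-1) : R2) = 1 := by
    rw [U, ← T_add, add_neg_cancel, T_zero]
  have hhomotopy : d ∘ₗ modelHomotopy v + modelHomotopy v ∘ₗ d +
      LinearMap.toSpanSingleton R2 (ModelB v → R2) (gen v) ∘ₗ LinearMap.proj ModelB.z0 =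
      LinearMap.id := by
    apply modelB_linearMap_ext
    · simp [hda, modelHomotopy_a, modelHomotopy_b, modelHomotopy_c]
    · simp [hdb, modelHomotopy_b, modelHomotopy_e, smul_smul, hTT]
    · simp [hdc, hda, modelHomotopy_c, modelHomotopy_e, smul_smul, hTT, add_right_comm, hself]
    · simp [hde, hdb, modelHomotopy_e, smul_smul, mul_comm, hTT]
    · simp only [LinearMap.add_apply, LinearMap.comp_apply, LinearMap.toSpanSingleton_apply,
        LinearMap.proj_apply, LinearMap.id_apply, Pi.single_eq_same, one_smul, modelHomotopy_z0,
        hdz0, map_add, map_zero, zero_add, modelHomotopy_zS_of_odd _ odd_one, gen_eq_add_evenTail]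
      rw [add_left_comm, hself, add_zero]
    · intro s r h1 hrv
      rcases Nat.even_or_odd r with hr | hr
      · obtain ⟨m, rfl⟩ : ∃ m, r = m + 1 := ⟨r - 1, by omega⟩
        have hm : Odd m := by grind
        have hm2 : Odd (m + 2) := hr.add_one
        simp [hdz s _ h1 hrv hr, modelHomotopy_zS_of_even s hr, modelHomotopy_zS_of_odd s hm,
          modelHomotopy_zS_of_odd s hm2, zS_apply_z0, evenTail_of_odd s hm hrv,
          add_assoc, hself]
      · simp [hdodd s r hr, modelHomotopy_zS_of_odd s hr, zS_apply_z0,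
          hdtail s v r hr (by omega)]
  refine ⟨hdd, ?_, fun x hx => ⟨x ModelB.z0, modelHomotopy v x, ?_⟩, ?_⟩
  · rw [LinearMap.mem_ker, gen_eq_add_evenTail]
    simp [hdz0, hdtail _ v 1 odd_one (by omega), hself]
  · have h := LinearMap.congr_fun hhomotopy x
    simp only [LinearMap.add_apply, LinearMap.comp_apply, LinearMap.toSpanSingleton_apply,
      LinearMap.proj_apply, LinearMap.id_apply, LinearMap.mem_ker.mp hx, map_zero, add_zero] at h
    nth_rewrite 2 [← h]
    rw [add_assoc, hself, add_zero]
  · rintro c ⟨y, hy⟩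
    simpa [hpd, gen_apply_z0] using (congrFun hy ModelB.z0).symm
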